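/- Let p be a prime, A an abelian group, and let a, b ∈ A^{⊗p} satisfy σ_1(a) = a, σ_1(b) = b, and a − b ∈ range(N_p). Then for every k ≥ 0, the element ω_{k+1}(a^{⊗p^k}) − ω_{k+1}(b^{⊗p^k}) of A^{⊗p^{k+1}} lies in the image of the norm map N_{p^{k+1}} = Σ_{s=0}^{p^{k+1}−1} σ_{k+1}^s, where ω_{k+1} is the permutation of (Fin p)^{k+1} reversing the order of the digits, acting on A^{⊗p^{k+1}} by reindexing. -/

import Mathlib

open scoped TensorProduct

section Digits

/-- Identification of digit tuples `(Fin p)^m` (first digit most significant) with `Fin (p^m)`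
via base-`p` digits. -/
def msbEquiv (p m : ℕ) : (Fin m → Fin p) ≃ Fin (p ^ m) :=
  (Equiv.piCongrLeft' (fun _ => Fin p) Fin.revPerm).trans finFunctionFinEquiv

/-- The digit rotation `τ_m : (i_1, …, i_m) ↦ (i_m, i_1, …, i_{m-1})` of digit tuples. -/
def rotPerm (p m : ℕ) [NeZero m] : Equiv.Perm (Fin m → Fin p) :=
  Equiv.piCongrLeft' (fun _ => Fin p) (Equiv.addRight (1 : Fin m))

/-- The permutation of `Fin (p^m)` corresponding to a permutation of digit tuples. -/
def digitPerm (p m : ℕ) (e : Equiv.Perm (Fin m → Fin p)) : Equiv.Perm (Fin (p ^ m)) :=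
  Equiv.permCongr (msbEquiv p m) e

end Digits

noncomputable section Tensor

/-- The `m`-fold tensor power over `ℤ` of an abelian group `A`, indexed by `Fin m`. -/
abbrev Tp (A : Type*) [AddCommGroup A] (m : ℕ) : Type _ := ⨂[ℤ] _ : Fin m, A

/-- The action of a permutation `e` of `Fin m` on the tensor power, by reindexing. -/
def permT (A : Type*) [AddCommGroup A] (m : ℕ) (e : Equiv.Perm (Fin m)) :
    Tp A m ≃ₗ[ℤ] Tp A m :=
  PiTensorProduct.reindex ℤ (fun _ : Fin m => A) e

/-- The cyclic permutation `σ_m` on the tensor power, induced by reindexing along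
`x ↦ x + 1` on `Fin m`, so that `σ(a_1 ⊗ ⋯ ⊗ a_m) = a_m ⊗ a_1 ⊗ ⋯ ⊗ a_{m-1}`. -/
def sigmaT (A : Type*) [AddCommGroup A] (m : ℕ) [NeZero m] : Tp A m ≃ₗ[ℤ] Tp A m :=
  permT A m (Equiv.addRight (1 : Fin m))

/-- The norm (transfer) map `N_m = Σ_{s=0}^{m-1} σ_m^s` on the tensor power. -/
def normT (A : Type*) [AddCommGroup A] (m : ℕ) [NeZero m] : Tp A m → Tp A m :=
  fun x => ∑ s ∈ Finset.range m, (⇑(sigmaT A m))^[s] x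

/-- Identification of tensor powers of equal sizes. -/
def tcast {A : Type*} [AddCommGroup A] {a b : ℕ} (h : a = b) : Tp A a ≃ₗ[ℤ] Tp A b :=
  TensorPower.cast ℤ A h

/-- Flattening of an iterated tensor power: `(A^{⊗N})^{⊗q} ≃ A^{⊗(N·q)}`, grouping
consecutive blocks of length `N`. -/
def flattenE (A : Type*) [AddCommGroup A] (N : ℕ) : (q : ℕ) →
    (⨂[ℤ] _ : Fin q, Tp A N) ≃ₗ[ℤ] Tp A (N * q)
  | 0 => (PiTensorProduct.isEmptyEquiv (Fin 0)).trans
      (PiTensorProduct.isEmptyEquiv (Fin 0)).symm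
  | q + 1 =>
      (TensorPower.mulEquiv (R := ℤ) (M := Tp A N) (n := q) (m := 1)).symm.trans <|
      (TensorProduct.congr (flattenE A N q)
        (PiTensorProduct.subsingletonEquiv (0 : Fin 1))).trans <|
      TensorPower.mulEquiv (R := ℤ) (M := A) (n := N * q) (m := N)

/-- The elementary tensor `c^{⊗B} ∈ A^{⊗(N·B)}` whose `B` consecutive blocks of length `N`
all equal `c ∈ A^{⊗N}`. -/
def tpow {A : Type*} [AddCommGroup A] {N : ℕ} (c : Tp A N) (B : ℕ) : Tp A (N * B) :=
  flattenE A N B (PiTensorProduct.tprod ℤ (fun _ : Fin B => c))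

/-- `c^{⊗B}`, recast to live in `A^{⊗m}` along an identification `N * B = m`. -/
def tpowTo {A : Type*} [AddCommGroup A] {N : ℕ} (c : Tp A N) (B : ℕ) {m : ℕ}
    (h : N * B = m) : Tp A m :=
  tcast (A := A) h (tpow c B)

end Tensor

/-- The digit reversal `ω_m : (i_1, …, i_m) ↦ (i_m, …, i_1)` of digit tuples. -/
def revDigits (p m : ℕ) : Equiv.Perm (Fin m → Fin p) :=
  Equiv.piCongrLeft' (fun _ => Fin p) Fin.revPerm

/-- If `T` permutes a finite set `U` with all orbits of size `n`, and `w` intertwines `T` with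
`σ`, then the sum of `w` over `U` is a norm for `σ`. -/
theorem exists_sum_iterate_eq_sum {α M : Type*} [DecidableEq α] [AddCommMonoid M]
    (σ : M →+ M) {n : ℕ} (hn : 0 < n) (T : α → α) (w : α → M)
    (hw : ∀ f, w (T f) = σ (w f)) (U : Finset α) (hU : ∀ f ∈ U, T f ∈ U)
    (hper : ∀ f ∈ U, Function.minimalPeriod T f = n) :
    ∃ x, ∑ s ∈ Finset.range n, σ^[s] x = ∑ f ∈ U, w f := by
  induction U using Finset.strongInduction with
  | H U ih =>
    rcases U.eq_empty_or_nonempty with rfl | ⟨f, hf⟩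
    · exact ⟨0, by simp [iterate_map_zero]⟩
    have hTf : T^[n] f = f := by
      rw [← hper f hf]; exact Function.iterate_minimalPeriod
    have hinj : Set.InjOn (fun s => T^[s] f) (Finset.range n) := by
      intro i hi j hj hij
      have h := Function.iterate_injOn_Iio_minimalPeriod (f := T) (x := f)
      rw [hper f hf] at h
      exact h (by simpa using hi) (by simpa using hj) hij
    set O := (Finset.range n).image (fun s => T^[s] f) with hO
    have hOU : O ⊆ U := by
      intro g hg
      obtain ⟨s, -, rfl⟩ := Finset.mem_image.1 hg
      clear hg
      induction s with
      | zero => exact hf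
      | succ s ihs =>
        simp only [Function.iterate_succ_apply']
        exact hU _ ihs
    have hfO : f ∈ O := Finset.mem_image.2 ⟨0, by simpa using hn, rfl⟩
    have hOT : ∀ g ∈ O, T g ∈ O := by
      intro g hg
      obtain ⟨s, hs, rfl⟩ := Finset.mem_image.1 hg
      rw [Finset.mem_range] at hs
      rcases Nat.lt_or_ge (s + 1) n with h | h
      · exact Finset.mem_image.2 ⟨s + 1, by simpa using h, Function.iterate_succ_apply' _ _ _⟩
      · obtain rfl : s + 1 = n := by omega
        rw [Function.iterate_succ_apply'] at hTf
        simpa only [hTf] using hfO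
    have hOT' : ∀ s, ∀ g ∈ O, T^[s] g ∈ O := by
      intro s
      induction s with
      | zero => intro g hg; exact hg
      | succ s ihs => intro g hg; exact ihs _ (hOT g hg)
    obtain ⟨x, hx⟩ := ih (U \ O) (Finset.sdiff_ssubset hOU ⟨f, hfO⟩)
      (by
        intro g hg
        rw [Finset.mem_sdiff] at hg ⊢
        refine ⟨hU g hg.1, fun h => hg.2 ?_⟩
        have h2 := hOT' (n - 1) _ h
        rw [← Function.iterate_succ_apply, Nat.succ_eq_add_one, Nat.sub_add_cancel hn,
          ← hper g hg.1, Function.iterate_minimalPeriod] at h2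
        exact h2)
      (fun g hg => hper g (Finset.mem_sdiff.1 hg).1)
    refine ⟨x + w f, ?_⟩
    have hws : ∀ s, w (T^[s] f) = σ^[s] (w f) := by
      intro s
      induction s with
      | zero => rfl
      | succ s ihs => rw [Function.iterate_succ_apply', Function.iterate_succ_apply', hw, ihs]
    rw [← Finset.sum_sdiff hOU, ← hx, hO, Finset.sum_image hinj, ← Finset.sum_add_distrib]
    exact Finset.sum_congr rfl fun s _ => by rw [iterate_map_add, hws]

/-- Two multilinear maps on tensor products agreeing on families of elementary tensors are equal. -/
theorem MultilinearMap.ext_tprod {R ι κ N A : Type*} [CommSemiring R] [Fintype ι]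
    [AddCommMonoid A] [Module R A] [AddCommMonoid N] [Module R N]
    {Φ Ψ : MultilinearMap R (fun _ : ι => ⨂[R] _ : κ, A) N}
    (h : ∀ x : ι → κ → A, Φ (fun i => PiTensorProduct.tprod R (x i)) =
      Ψ (fun i => PiTensorProduct.tprod R (x i))) : Φ = Ψ := by
  classical
  have key : ∀ (s : Finset ι) (f : ι → ⨂[R] _ : κ, A),
      (∀ i ∉ s, ∃ x, f i = PiTensorProduct.tprod R x) → Φ f = Ψ f := by
    intro s
    induction s using Finset.induction with
    | empty =>
      intro f hf
      choose x hx using fun i => hf i (Finset.notMem_empty i)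
      obtain rfl : f = fun i => PiTensorProduct.tprod R (x i) := funext hx
      exact h x
    | insert a s _ ih =>
      intro f hf
      have : ∀ z, Φ (Function.update f a z) = Ψ (Function.update f a z) := by
        intro z
        induction z using PiTensorProduct.induction_on with
        | smul_tprod r x =>
          rw [MultilinearMap.map_update_smul, MultilinearMap.map_update_smul]
          congr 1
          refine ih _ fun i hi => ?_
          by_cases hia : i = a
          · subst hia; exact ⟨x, Function.update_self ..⟩
          · rw [Function.update_of_ne hia]
            exact hf i (by simp [hia, hi])
        | add x y hx hy =>
          rw [MultilinearMap.map_update_add, MultilinearMap.map_update_add, hx, hy]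
      simpa using this (f a)
  exact MultilinearMap.ext fun f => key Finset.univ f fun i hi => absurd (Finset.mem_univ i) hi

/-- Cyclic shift of families, twisted by `g` upon wrapping around. -/
def twistShift {q : ℕ} [NeZero q] {X : Type*} (g : X → X) (f : Fin q → X) : Fin q → X :=
  fun r => if r = 0 then g (f (r - 1)) else f (r - 1)

theorem Fin.val_sub_one_eq_ite {q : ℕ} [NeZero q] (r : Fin q) :
    (r - 1).val = if r.val = 0 then q - 1 else r.val - 1 := by
  obtain ⟨n, rfl⟩ := Nat.exists_eq_succ_of_ne_zero (NeZero.ne q)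
  rw [Fin.coe_sub_one]
  exact if_congr Fin.ext_iff rfl rfl

theorem twistShift_iterate {q : ℕ} [NeZero q] {X : Type*} (g : X → X) (f : Fin q → X) :
    (twistShift g)^[q] f = g ∘ f := by
  have key : ∀ s ≤ q, ∀ r t : Fin q, ((t : ℕ) + s = r → (twistShift g)^[s] f r = f t) ∧
      ((t : ℕ) + s = r + q → (twistShift g)^[s] f r = g (f t)) := by
    intro s
    induction s with
    | zero =>
      intro _ r t
      refine ⟨fun h => ?_, fun h => ?_⟩
      · rw [Function.iterate_zero_apply, Fin.ext (a := r) (b := t) (by omega)]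
      · omega
    | succ s ih =>
      intro hs r t
      have hr := Fin.val_sub_one_eq_ite r
      obtain ⟨h1, h2⟩ := ih (by omega) (r - 1) t
      rw [Function.iterate_succ_apply', twistShift]
      by_cases h0 : r = 0
      · have h0' : r.val = 0 := by simp [h0]
        rw [if_pos h0'] at hr
        rw [if_pos h0]
        exact ⟨fun h => by omega, fun h => by rw [h1 (by omega)]⟩
      · have h0' : r.val ≠ 0 := fun h => h0 (Fin.ext (by simpa using h))
        rw [if_neg h0'] at hr
        rw [if_neg h0]
        exact ⟨fun h => h1 (by omega), fun h => h2 (by omega)⟩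
  funext r
  exact (key q le_rfl r r).2 rfl

theorem twistShift_comp {q : ℕ} [NeZero q] {X Y : Type*} {g : X → X} {g' : Y → Y} {v : X → Y}
    (hv : ∀ x, v (g x) = g' (v x)) (f : Fin q → X) :
    v ∘ twistShift g f = twistShift g' (v ∘ f) := by
  funext r
  simp only [twistShift, Function.comp_apply]
  split_ifs <;> simp [hv]

theorem minimalPeriod_twistShift {p k : ℕ} [NeZero p] (hp : p.Prime)
    {f : Fin (p ^ k) → Option (Fin p)} (hf : f ≠ fun _ => none) :
    Function.minimalPeriod (twistShift (Option.map (· + 1))) f = p ^ (k + 1) := by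
  have : Fact p.Prime := ⟨hp⟩
  apply Function.minimalPeriod_eq_prime_pow
  · intro h
    rw [Function.IsPeriodicPt, Function.IsFixedPt, twistShift_iterate] at h
    refine hf (funext fun r => ?_)
    have h1 := congrFun h r
    cases hr : f r with
    | none => rfl
    | some j =>
      simp only [Function.comp_apply, hr, Option.map_some, Option.some.injEq] at h1
      have : (1 : Fin p) = 0 := by simpa using h1
      rw [Fin.ext_iff] at this
      rw [Fin.val_one', Nat.mod_eq_of_lt hp.one_lt] at this
      simp at this
  · have key : ∀ m, ((twistShift (Option.map (· + 1)))^[p ^ k])^[m] f =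
        fun r => (f r).map (· + Fin.ofNat p m) := by
      intro m
      induction m with
      | zero => funext r; cases h : f r <;> simp [h]
      | succ m ih =>
        rw [Function.iterate_succ_apply', ih, twistShift_iterate]
        funext r
        cases h : f r <;> simp [h]
        rw [add_assoc]; congr 1
        apply Fin.ext; simp [Fin.val_add]
    rw [Function.IsPeriodicPt, Function.IsFixedPt, pow_succ, Function.iterate_mul, key]
    funext r
    cases f r <;> simp

theorem sigmaT_tprod (A : Type*) [AddCommGroup A] (m : ℕ) [NeZero m] (x : Fin m → A) :
    sigmaT A m (PiTensorProduct.tprod ℤ x) = PiTensorProduct.tprod ℤ fun i => x (i - 1) := by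
  rw [sigmaT, permT, PiTensorProduct.reindex_tprod]
  congr 1
  funext i
  rw [Equiv.addRight_symm, Equiv.coe_addRight, sub_eq_add_neg]

theorem mod_lt_of_fin {n q : ℕ} [NeZero q] (y : Fin n) : (y : ℕ) % q < q :=
  Nat.mod_lt _ (Nat.pos_of_ne_zero (NeZero.ne q))

/-- A multilinear map interleaving `q` tensors of length `p` intertwines the twisted shift
with the cyclic permutation. -/
theorem sigmaT_interleave {p q n : ℕ} [NeZero p] [NeZero q] [NeZero n] (hn : n = p * q)
    {A : Type*} [AddCommGroup A] (Φ : MultilinearMap ℤ (fun _ : Fin q => Tp A p) (Tp A n))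
    (hΦ : ∀ x : Fin q → Fin p → A, Φ (fun r => PiTensorProduct.tprod ℤ (x r)) =
      PiTensorProduct.tprod ℤ fun y : Fin n =>
        x ⟨y % q, mod_lt_of_fin y⟩
          ⟨y / q, Nat.div_lt_of_lt_mul (by rw [mul_comm, ← hn]; exact y.2)⟩)
    (f : Fin q → Tp A p) :
    sigmaT A n (Φ f) = Φ (twistShift (sigmaT A p) f) := by
  let Ψ : MultilinearMap ℤ (fun _ : Fin q => Tp A p) (Tp A n) :=
    (Φ.compLinearMap fun r => if r = 0 then (sigmaT A p).toLinearMap else LinearMap.id).domDomCongr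
      (Equiv.subRight (1 : Fin q))
  have hΨ : ∀ f, Ψ f = Φ (twistShift (sigmaT A p) f) := by
    intro f
    simp only [Ψ, MultilinearMap.domDomCongr_apply, MultilinearMap.compLinearMap_apply]
    congr 1
    funext r
    simp only [twistShift]
    split_ifs <;> rfl
  rw [← hΨ]
  suffices (sigmaT A n).toLinearMap.compMultilinearMap Φ = Ψ from
    DFunLike.congr_fun this f
  refine MultilinearMap.ext_tprod fun x => ?_
  have hx : twistShift (sigmaT A p) (fun r => PiTensorProduct.tprod ℤ (x r)) =
      fun r => PiTensorProduct.tprod ℤ (twistShift (fun u i => u (i - 1)) x r) := by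
    funext r
    simp only [twistShift]
    split_ifs
    · rw [sigmaT_tprod]
    · rfl
  rw [hΨ, hx, hΦ, LinearMap.compMultilinearMap_apply, hΦ, LinearEquiv.coe_coe, sigmaT_tprod]
  congr 1
  funext y
  have hq : 0 < q := Nat.pos_of_ne_zero (NeZero.ne q)
  have hy := Fin.val_sub_one_eq_ite y
  have hdm := Nat.div_add_mod (y : ℕ) q
  have hml := Nat.mod_lt (y : ℕ) hq
  set d := (y : ℕ) / q with hd
  set m := (y : ℕ) % q with hm
  have hdp : d < p := Nat.div_lt_of_lt_mul (by rw [mul_comm, ← hn]; exact y.2)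
  have uniq : ∀ u v : ℕ, v < q → ((y - 1 : Fin n) : ℕ) = q * u + v →
      ((y - 1 : Fin n) : ℕ) / q = u ∧ ((y - 1 : Fin n) : ℕ) % q = v := by
    intro u v hv h
    rw [h]
    exact ⟨by rw [Nat.mul_add_div hq, Nat.div_eq_of_lt hv, add_zero],
      by rw [Nat.mul_add_mod, Nat.mod_eq_of_lt hv]⟩
  have hm1 := Fin.val_sub_one_eq_ite (⟨m, hml⟩ : Fin q)
  have hd1 := Fin.val_sub_one_eq_ite (⟨d, hdp⟩ : Fin p)
  simp only at hm1 hd1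
  simp only [twistShift]
  by_cases h0 : m = 0
  · rw [if_pos (Fin.ext (by simpa using h0))]
    rw [if_pos h0] at hm1
    have : ((y - 1 : Fin n) : ℕ) = q * ((⟨d, hdp⟩ - 1 : Fin p) : ℕ) + (q - 1) := by
      rw [hy, hd1]
      by_cases hd0 : d = 0
      · have : (y : ℕ) = 0 := by rw [← hdm, hd0, h0]; simp
        rw [if_pos this, if_pos hd0, hn, Nat.mul_sub, mul_comm p q]
        have : q * 1 ≤ q * p := Nat.mul_le_mul_left _ (Nat.pos_of_ne_zero (NeZero.ne p))
        omega
      · have hqd : q * 1 ≤ q * d := Nat.mul_le_mul_left _ (Nat.pos_of_ne_zero hd0)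
        rw [if_neg (by omega), if_neg hd0, Nat.mul_sub]
        omega
    obtain ⟨h1, h2⟩ := uniq _ _ (by omega) this
    exact congrArg₂ x (Fin.ext (h2.trans hm1.symm)) (Fin.ext h1)
  · rw [if_neg (fun h => h0 (by simpa using congrArg Fin.val h))]
    rw [if_neg h0] at hm1
    obtain ⟨h1, h2⟩ := uniq d (m - 1) (by omega) (by rw [hy, if_neg (by omega)]; omega)
    exact congrArg₂ x (Fin.ext (h2.trans hm1.symm)) (Fin.ext h1)

theorem mulEquiv_tprod {R M : Type*} [CommSemiring R] [AddCommMonoid M] [Module R M] {i j : ℕ}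
    (a : Fin i → M) (b : Fin j → M) :
    TensorPower.mulEquiv (PiTensorProduct.tprod R a ⊗ₜ[R] PiTensorProduct.tprod R b) =
      PiTensorProduct.tprod R (Fin.append a b) :=
  TensorPower.tprod_mul_tprod R a b

theorem flattenE_succ_tprod (A : Type*) [AddCommGroup A] (N q : ℕ) (c : Fin (q + 1) → Tp A N) :
    flattenE A N (q + 1) (PiTensorProduct.tprod ℤ c) =
      TensorPower.mulEquiv (R := ℤ) (M := A) (n := N * q) (m := N)
        (flattenE A N q (PiTensorProduct.tprod ℤ fun i => c i.castSucc) ⊗ₜ[ℤ] c (Fin.last q)) := by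
  have h : (TensorPower.mulEquiv (R := ℤ) (M := Tp A N) (n := q) (m := 1)).symm
      (PiTensorProduct.tprod ℤ c) = (PiTensorProduct.tprod ℤ fun i => c i.castSucc) ⊗ₜ[ℤ]
        PiTensorProduct.tprod ℤ fun _ : Fin 1 => c (Fin.last q) := by
    rw [LinearEquiv.symm_apply_eq, mulEquiv_tprod]
    congr 1
    funext i
    refine Fin.lastCases ?_ (fun i => ?_) i
    · exact (Fin.append_right (fun i : Fin q => c i.castSucc) (fun _ => c (Fin.last q)) (0 : Fin 1)).symm
    · exact (Fin.append_left (fun i => c i.castSucc) (fun _ : Fin 1 => c (Fin.last q)) i).symm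
  simp only [flattenE, LinearEquiv.trans_apply]
  rw [h, TensorProduct.congr_tmul, PiTensorProduct.subsingletonEquiv_apply_tprod]

theorem flattenE_tprod (A : Type*) [AddCommGroup A] (N : ℕ) [NeZero N] (q : ℕ)
    (x : Fin q → Fin N → A) :
    flattenE A N q (PiTensorProduct.tprod ℤ fun i => PiTensorProduct.tprod ℤ (x i)) =
      PiTensorProduct.tprod ℤ fun y : Fin (N * q) =>
        x ⟨y / N, Nat.div_lt_of_lt_mul y.2⟩ ⟨y % N, mod_lt_of_fin y⟩ := by
  have hN : 0 < N := Nat.pos_of_ne_zero (NeZero.ne N)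
  induction q with
  | zero =>
    simp only [flattenE, LinearEquiv.trans_apply]
    rw [LinearEquiv.symm_apply_eq, PiTensorProduct.isEmptyEquiv_apply_tprod]
    exact (PiTensorProduct.isEmptyEquiv_apply_tprod (R := ℤ) (Fin 0) _).symm
  | succ q ih =>
    rw [flattenE_succ_tprod, ih fun i => x i.castSucc, mulEquiv_tprod]
    congr 1
    funext y
    refine Fin.addCases (fun y => ?_) (fun y => ?_) y
    · rw [Fin.append_left]
      rfl
    · rw [Fin.append_right]
      congr 1
      · apply Fin.ext
        simp [Nat.mul_add_div hN, Nat.div_eq_of_lt y.2]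
      · apply Fin.ext
        simp [Nat.mod_eq_of_lt y.2]

theorem msbEquiv_val (p m : ℕ) (d : Fin m → Fin p) :
    (msbEquiv p m d : ℕ) = ∑ i, (d (Fin.rev i) : ℕ) * p ^ (i : ℕ) := rfl

theorem msbEquiv_succ_eq_head (p m : ℕ) (d : Fin (m + 1) → Fin p) :
    (msbEquiv p (m + 1) d : ℕ) = p ^ m * d 0 + msbEquiv p m (Fin.tail d) := by
  rw [msbEquiv_val, msbEquiv_val, Fin.sum_univ_castSucc, add_comm, mul_comm]
  congr 1
  · simp
  · exact Finset.sum_congr rfl fun i _ => by rw [Fin.rev_castSucc]; rfl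

theorem msbEquiv_succ_eq_last (p m : ℕ) (d : Fin (m + 1) → Fin p) :
    (msbEquiv p (m + 1) d : ℕ) = p * msbEquiv p m (Fin.init d) + d (Fin.last m) := by
  rw [msbEquiv_val, msbEquiv_val, Fin.sum_univ_succ, add_comm, Finset.mul_sum]
  congr 1
  · exact Finset.sum_congr rfl fun i _ => by
      rw [Fin.rev_succ, Fin.val_succ, pow_succ]; simp only [Fin.init]; ring
  · simp

theorem digitPerm_revDigits_symm (p m : ℕ) (y : Fin (p ^ m)) :
    (digitPerm p m (revDigits p m)).symm y =
      msbEquiv p m fun i => (msbEquiv p m).symm y (Fin.rev i) := by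
  rw [Equiv.symm_apply_eq]
  simp only [digitPerm, revDigits, Equiv.permCongr_apply, Equiv.symm_apply_apply]
  rw [← Equiv.symm_apply_eq]
  funext i
  simp

theorem digitPerm_revDigits_symm_val (p k : ℕ) [NeZero p] (y : Fin (p ^ (k + 1))) :
    ((digitPerm p (k + 1) (revDigits p (k + 1))).symm y : ℕ) =
      p * (digitPerm p k (revDigits p k)).symm ⟨y % p ^ k, mod_lt_of_fin y⟩ + y / p ^ k := by
  obtain ⟨d, rfl⟩ := (msbEquiv p (k + 1)).surjective y
  have hpk : 0 < p ^ k := Nat.pos_of_ne_zero (NeZero.ne _)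
  have hy := msbEquiv_succ_eq_head p k d
  have hlt := (msbEquiv p k (Fin.tail d)).2
  have h1 : (msbEquiv p (k + 1) d : ℕ) / p ^ k = d 0 := by
    rw [hy, Nat.mul_add_div hpk, Nat.div_eq_of_lt hlt, add_zero]
  have h2 : (⟨(msbEquiv p (k + 1) d : ℕ) % p ^ k, mod_lt_of_fin _⟩ : Fin (p ^ k)) =
      msbEquiv p k (Fin.tail d) := by
    apply Fin.ext
    change (msbEquiv p (k + 1) d : ℕ) % p ^ k = _
    rw [hy, Nat.mul_add_mod, Nat.mod_eq_of_lt hlt]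
  rw [h1, h2, digitPerm_revDigits_symm, digitPerm_revDigits_symm, Equiv.symm_apply_apply,
    Equiv.symm_apply_apply, msbEquiv_succ_eq_last]
  congr 1
  · congr 3
    funext i
    simp only [Fin.init, Fin.tail, Fin.rev_castSucc]
  · simp

/-- The digit reversal of a tensor power of length `p ^ (k + 1)`, as a multilinear map of its
`p ^ k` blocks, the blocks being permuted by digit reversal. -/
noncomputable def revBlocks (p : ℕ) (A : Type*) [AddCommGroup A] (k : ℕ) :
    MultilinearMap ℤ (fun _ : Fin (p ^ k) => Tp A p) (Tp A (p ^ (k + 1))) :=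
  ((permT A (p ^ (k + 1)) (digitPerm p (k + 1) (revDigits p (k + 1)))).toLinearMap ∘ₗ
    (tcast (A := A) (pow_succ' p k).symm).toLinearMap ∘ₗ
    (flattenE A p (p ^ k)).toLinearMap).compMultilinearMap
      ((PiTensorProduct.tprod ℤ).domDomCongr (digitPerm p k (revDigits p k)))

theorem revBlocks_apply (p : ℕ) (A : Type*) [AddCommGroup A] (k : ℕ)
    (f : Fin (p ^ k) → Tp A p) :
    revBlocks p A k f = permT A (p ^ (k + 1)) (digitPerm p (k + 1) (revDigits p (k + 1)))
      (tcast (A := A) (pow_succ' p k).symm (flattenE A p (p ^ k)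
        (PiTensorProduct.tprod ℤ fun i => f (digitPerm p k (revDigits p k) i)))) := rfl

theorem revBlocks_tprod (p : ℕ) [NeZero p] (A : Type*) [AddCommGroup A] (k : ℕ)
    (x : Fin (p ^ k) → Fin p → A) :
    revBlocks p A k (fun r => PiTensorProduct.tprod ℤ (x r)) =
      PiTensorProduct.tprod ℤ fun y : Fin (p ^ (k + 1)) =>
        x ⟨y % p ^ k, mod_lt_of_fin y⟩
          ⟨y / p ^ k, Nat.div_lt_of_lt_mul (by rw [← pow_succ]; exact y.2)⟩ := by
  have hp : 0 < p := Nat.pos_of_ne_zero (NeZero.ne p)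
  rw [revBlocks_apply, flattenE_tprod A p (p ^ k) fun i => x (digitPerm p k (revDigits p k) i),
    tcast, TensorPower.cast_tprod, permT, PiTensorProduct.reindex_tprod]
  congr 1
  funext y
  have hy := digitPerm_revDigits_symm_val p k y
  have hlt : (y : ℕ) / p ^ k < p := Nat.div_lt_of_lt_mul (by rw [← pow_succ]; exact y.2)
  simp only [Function.comp_apply, Fin.val_cast]
  congr 1
  · rw [← Equiv.eq_symm_apply]
    apply Fin.ext
    change ((digitPerm p (k + 1) (revDigits p (k + 1))).symm y : ℕ) / p = _
    rw [hy, Nat.mul_add_div hp, Nat.div_eq_of_lt hlt, add_zero]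
  · apply Fin.ext
    change ((digitPerm p (k + 1) (revDigits p (k + 1))).symm y : ℕ) % p = _
    rw [hy, Nat.mul_add_mod, Nat.mod_eq_of_lt hlt]

theorem revBlocks_const (p : ℕ) (A : Type*) [AddCommGroup A] (k : ℕ) (c : Tp A p) :
    revBlocks p A k (fun _ => c) =
      permT A (p ^ (k + 1)) (digitPerm p (k + 1) (revDigits p (k + 1)))
        (tpowTo c (p ^ k) (pow_succ' p k).symm) := rfl

theorem sigmaT_iterate_self (A : Type*) [AddCommGroup A] (m : ℕ) [NeZero m] (c : Tp A m) :
    (sigmaT A m)^[m] c = c := by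
  suffices h : (sigmaT A m).toLinearMap ^ m = LinearMap.id by
    have := LinearMap.congr_fun h c
    rwa [Module.End.pow_apply] at this
  refine PiTensorProduct.ext (MultilinearMap.ext fun x => ?_)
  have key : ∀ s : ℕ, ((sigmaT A m).toLinearMap ^ s) (PiTensorProduct.tprod ℤ x) =
      PiTensorProduct.tprod ℤ fun i => x (i - Fin.ofNat m s) := by
    intro s
    induction s with
    | zero => simp
    | succ s ih =>
      rw [pow_succ', Module.End.mul_apply, ih, LinearEquiv.coe_coe, sigmaT_tprod]
      congr 1
      funext i
      rw [sub_sub]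
      congr 2
      apply Fin.ext
      simp [Fin.val_add, add_comm]
  rw [LinearMap.compMultilinearMap_apply, key]
  simp

/-- let `p` be a prime, `A` an abelian group, and `a b ∈ A^{⊗p}` with
`σ_1(a) = a`, `σ_1(b) = b` and `a - b ∈ range N_p`.  Then for every `k ≥ 0` the element
`ω_{k+1}(a^{⊗p^k}) - ω_{k+1}(b^{⊗p^k})` of `A^{⊗p^{k+1}}` lies in the image of the norm
map `N_{p^{k+1}}`, where `ω_{k+1}` is the digit reversal of `(Fin p)^{k+1}` acting by
reindexing. -/
theorem statement6 (p : ℕ) [NeZero p] (hp : p.Prime) (A : Type*) [AddCommGroup A]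
    (a b : Tp A p) (ha : sigmaT A p a = a) (hb : sigmaT A p b = b)
    (hab : a - b ∈ Set.range (normT A p)) (k : ℕ) :
    permT A (p ^ (k + 1)) (digitPerm p (k + 1) (revDigits p (k + 1)))
        (tpowTo a (p ^ k) (pow_succ' p k).symm)
      - permT A (p ^ (k + 1)) (digitPerm p (k + 1) (revDigits p (k + 1)))
        (tpowTo b (p ^ k) (pow_succ' p k).symm)
      ∈ Set.range (normT A (p ^ (k + 1))) := by
  obtain ⟨c, hc⟩ := hab
  let v : Option (Fin p) → Tp A p := fun s => s.elim b fun j => (sigmaT A p)^[j] c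
  have hv : ∀ s, v (s.map (· + 1)) = sigmaT A p (v s) := by
    rintro (_ | j)
    · exact hb.symm
    · change (sigmaT A p)^[(j + 1 : Fin p)] c = sigmaT A p ((sigmaT A p)^[j] c)
      rw [← Function.iterate_succ_apply' (sigmaT A p)]
      have hj := Fin.val_sub_one_eq_ite (j + 1)
      rw [add_sub_cancel_right] at hj
      split_ifs at hj with h
      · rw [h, hj, Nat.succ_eq_add_one, Nat.sub_add_cancel hp.one_le, sigmaT_iterate_self]
        rfl
      · rw [hj, Nat.succ_eq_add_one, Nat.sub_add_cancel (Nat.pos_of_ne_zero h)]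
  have hav : a = ∑ s, v s := by
    rw [Fintype.sum_option]
    change a = b + ∑ j : Fin p, (sigmaT A p)^[j] c
    rw [Fin.sum_univ_eq_sum_range (fun j => (sigmaT A p)^[j] c) p]
    exact (sub_eq_iff_eq_add'.1 hc.symm)
  have hw : ∀ f : Fin (p ^ k) → Option (Fin p),
      revBlocks p A k (v ∘ twistShift (Option.map (· + 1)) f) =
        sigmaT A (p ^ (k + 1)) (revBlocks p A k (v ∘ f)) := by
    intro f
    rw [twistShift_comp hv, sigmaT_interleave (pow_succ' p k) _ (revBlocks_tprod p A k)]
  obtain ⟨x, hx⟩ := exists_sum_iterate_eq_sum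
    (sigmaT A (p ^ (k + 1))).toLinearMap.toAddMonoidHom (NeZero.pos (p ^ (k + 1)))
    (twistShift (Option.map (· + 1))) (fun f => revBlocks p A k (v ∘ f)) hw
    (Finset.univ.erase fun _ => none)
    (by
      intro f hf
      simp only [Finset.mem_erase, Finset.mem_univ, and_true] at hf ⊢
      intro h
      refine hf (funext fun r => ?_)
      have h1 := congrFun h (r + 1)
      simp only [twistShift, add_sub_cancel_right] at h1
      split_ifs at h1
      · simpa using h1
      · exact h1)
    (fun f hf => minimalPeriod_twistShift hp (Finset.ne_of_mem_erase hf))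
  refine ⟨x, ?_⟩
  rw [← revBlocks_const, ← revBlocks_const, hav, MultilinearMap.map_sum,
    ← Finset.add_sum_erase _ _ (Finset.mem_univ fun _ : Fin (p ^ k) => (none : Option (Fin p)))]
  exact hx.trans (add_sub_cancel_left _ _).symm
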